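/- Let G=(V,E) be a finite simple graph with a partition {B,R} of V, d≥3 an integer, D=binom(d+1,2), and f(F)=D(|V(F)|−1)−|R(F)|. Let C be a nontrivial P-connected component of the polymatroid PM_f(G,{B,R}). Let G' be the graph obtained from G by deleting all edges of C, adding a new vertex v_c, and adding the star S = { {v_c, w} : w ∈ V(C) }, with the partition P' = {B∪{v_c}, R} of V∪{v_c}. Then every edge of f∘S is a coloop of the count matroid M_f(f∘G', P'), i.e., it belongs to every base (equivalently, it lies in no circuit of M_f(f∘G', P')). -/

import Mathlib

/- STATEMENT 17: after simplifying a nontrivial P-connected component `C` (replacing it by a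
star on `V(C)` with a new body vertex `v_c`), every copied star edge is a coloop of the
count matroid `M_f(f∘G', P')`: it belongs to every base, equivalently it lies in no
circuit. -/

set_option synthInstance.maxHeartbeats 1000000
set_option maxHeartbeats 1000000

open scoped Classical

noncomputable section

/-- The set `V(F)` of vertices spanned by an edge set `F` in a multigraph whose edges `e : ε`
have endpoint pairs `π e : Sym2 V`. -/
def VF {V ε : Type} [Fintype V] (π : ε → Sym2 V) (F : Finset ε) : Finset V :=
  Finset.univ.filter (fun v => ∃ e ∈ F, v ∈ π e)

/-- The count function `f(F) = D·|V(F)| − D − |R(F)|`. -/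
def fCnt {V ε : Type} [Fintype V] (D : ℕ) (π : ε → Sym2 V) (R : Finset V)
    (F : Finset ε) : ℤ :=
  (D : ℤ) * (VF π F).card - D - ((VF π F) ∩ R).card

/-- Independence in the count matroid `M_f`: `|F'| ≤ f(F')` for all nonempty `F' ⊆ F`. -/
def CIndep {V ε : Type} [Fintype V] (D : ℕ) (π : ε → Sym2 V) (R : Finset V)
    (F : Finset ε) : Prop :=
  ∀ F' ⊆ F, F'.Nonempty → (F'.card : ℤ) ≤ fCnt D π R F'

/-- The rank function of the count matroid `M_f`: the maximum size of an independent subset. -/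
def cRank {V ε : Type} [Fintype V] (D : ℕ) (π : ε → Sym2 V) (R : Finset V)
    (F : Finset ε) : ℕ :=
  sSup {n : ℕ | ∃ F' ⊆ F, CIndep D π R F' ∧ F'.card = n}

/-- A circuit of the count matroid: a minimal dependent set. -/
def CCircuit {V ε : Type} [Fintype V] (D : ℕ) (π : ε → Sym2 V) (R : Finset V)
    (C : Finset ε) : Prop :=
  ¬ CIndep D π R C ∧ ∀ C' ⊂ C, CIndep D π R C'

/-- `F` is M-connected: every pair of its elements lies on a common circuit contained in `F`
(singletons and the empty set count as M-connected). -/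
def MConn {V ε : Type} [Fintype V] (D : ℕ) (π : ε → Sym2 V) (R : Finset V)
    (F : Finset ε) : Prop :=
  F.card ≤ 1 ∨ ∀ e ∈ F, ∀ e' ∈ F, ∃ C ⊆ F, CCircuit D π R C ∧ e ∈ C ∧ e' ∈ C

/-- `X` is an M-connected component of the count matroid restricted to the ground set `G`:
a maximal M-connected subset of `G`. -/
def MConnComp {V ε : Type} [Fintype V] (D : ℕ) (π : ε → Sym2 V) (R : Finset V)
    (G X : Finset ε) : Prop :=
  X ⊆ G ∧ MConn D π R X ∧ ∀ Y ⊆ G, MConn D π R Y → X ⊆ Y → Y = X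

/-- `P` is a partition of `F` into nonempty parts. -/
def IsPartitionOf {ε : Type} [DecidableEq ε] (F : Finset ε) (P : Finset (Finset ε)) : Prop :=
  (∀ p ∈ P, p.Nonempty) ∧ (P : Set (Finset ε)).PairwiseDisjoint id ∧ P.biUnion id = F

/-- The induced polymatroid function `f̂(F) = min Σᵢ f(Fᵢ)` over partitions of `F` into
nonempty parts (with `f̂(∅) = 0`). -/
def fHat {V ε : Type} [Fintype V] [DecidableEq ε] (D : ℕ) (π : ε → Sym2 V) (R : Finset V)
    (F : Finset ε) : ℤ :=
  sInf {s : ℤ | ∃ P : Finset (Finset ε), IsPartitionOf F P ∧ s = ∑ p ∈ P, fCnt D π R p}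

/-- `F` is P-connected in the polymatroid `(E, f̂)`: no partition of `F` into at least two
nonempty parts satisfies `f̂(F) = Σᵢ f̂(Fᵢ)`. -/
def PConn {V ε : Type} [Fintype V] [DecidableEq ε] (D : ℕ) (π : ε → Sym2 V) (R : Finset V)
    (F : Finset ε) : Prop :=
  F.Nonempty ∧ ∀ P : Finset (Finset ε), IsPartitionOf F P → 2 ≤ P.card →
    fHat D π R F ≠ ∑ p ∈ P, fHat D π R p

/-- `C` is a P-connected component of the polymatroid on the ground set `G`: a maximal
P-connected subset of `G`. -/
def PConnComp {V ε : Type} [Fintype V] [DecidableEq ε] (D : ℕ) (π : ε → Sym2 V) (R : Finset V)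
    (G C : Finset ε) : Prop :=
  C ⊆ G ∧ PConn D π R C ∧ ∀ C' ⊆ G, PConn D π R C' → C ⊆ C' → C' = C

/-- The multiplicity `f({e}) = D − |R({e})|` of an edge in `f∘G`. -/
def fMult {V ε : Type} [Fintype V] (D : ℕ) (π : ε → Sym2 V) (R : Finset V) (e : ε) : ℕ :=
  D - ((VF π ({e} : Finset ε)) ∩ R).card

/-- The set `f∘F` of all copies of edges of `F` in `f∘G`; copies of `e` are indexed by
`i : Fin D` with `i < f({e})`. -/
def fCopy {V ε : Type} [Fintype V] [DecidableEq ε] (D : ℕ) (π : ε → Sym2 V) (R : Finset V)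
    (F : Finset ε) : Finset (ε × Fin D) :=
  F.biUnion (fun e =>
    ({e} : Finset ε) ×ˢ (Finset.univ.filter (fun i : Fin D => (i : ℕ) < fMult D π R e)))

end

noncomputable def gW {V : Type} (D : ℕ) (R U : Finset V) : ℤ :=
  ∑ v ∈ U, ((D : ℤ) - if v ∈ R then 1 else 0)

theorem fCnt_eq {V ε : Type} [Fintype V] (D : ℕ) (π : ε → Sym2 V) (R : Finset V)
    (F : Finset ε) : fCnt D π R F = gW D R (VF π F) - D := by
  unfold fCnt gW
  rw [Finset.sum_sub_distrib, Finset.sum_const, Finset.sum_boole, Finset.filter_mem_eq_inter]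
  simp only [nsmul_eq_mul]
  ring

theorem gW_mono {V : Type} (D : ℕ) (hD : 1 ≤ D) (R : Finset V) {U U' : Finset V} (h : U ⊆ U') :
    gW D R U ≤ gW D R U' := by
  unfold gW
  apply Finset.sum_le_sum_of_subset_of_nonneg h
  intro v _ _
  split_ifs <;> omega

theorem gW_union {V : Type} [DecidableEq V] (D : ℕ) (R : Finset V) (U U' : Finset V) :
    gW D R (U ∪ U') + gW D R (U ∩ U') = gW D R U + gW D R U' :=
  Finset.sum_union_inter

theorem gW_union_sdiff {V : Type} [DecidableEq V] (D : ℕ) (R : Finset V) (U U' : Finset V) :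
    gW D R (U ∪ U') = gW D R U + gW D R (U' \ U) := by
  unfold gW
  rw [← Finset.sum_union Finset.disjoint_sdiff, Finset.union_sdiff_self_eq_union]

theorem mem_VF {V ε : Type} [Fintype V] (π : ε → Sym2 V) (F : Finset ε) (v : V) :
    v ∈ VF π F ↔ ∃ e ∈ F, v ∈ π e := by
  simp [VF]

theorem VF_union {V ε : Type} [Fintype V] [DecidableEq V] [DecidableEq ε] (π : ε → Sym2 V)
    (A B : Finset ε) : VF π (A ∪ B) = VF π A ∪ VF π B := by
  ext v
  simp only [mem_VF, Finset.mem_union, or_and_right, exists_or]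

theorem fCnt_mono {V ε : Type} [Fintype V] (D : ℕ) (hD : 1 ≤ D) (π : ε → Sym2 V)
    (R : Finset V) {A B : Finset ε} (h : A ⊆ B) : fCnt D π R A ≤ fCnt D π R B := by
  rw [fCnt_eq, fCnt_eq]
  have : VF π A ⊆ VF π B := by
    intro v; simp only [mem_VF]; rintro ⟨e, he, hv⟩; exact ⟨e, h he, hv⟩
  have := gW_mono D hD R this
  omega

theorem fCnt_submod {V ε : Type} [Fintype V] [DecidableEq ε] (D : ℕ) (hD : 1 ≤ D)
    (π : ε → Sym2 V) (R : Finset V) (A B : Finset ε) :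
    fCnt D π R (A ∪ B) + fCnt D π R (A ∩ B) ≤ fCnt D π R A + fCnt D π R B := by
  classical
  simp only [fCnt_eq]
  have h1 : VF π (A ∩ B) ⊆ VF π A ∩ VF π B := by
    intro v
    simp only [mem_VF, Finset.mem_inter]
    rintro ⟨e, ⟨h1, h2⟩, hv⟩
    exact ⟨⟨e, h1, hv⟩, ⟨e, h2, hv⟩⟩
  have h2 := gW_mono D hD R h1
  have h3 := gW_union D R (VF π A) (VF π B)
  rw [VF_union]
  omega

section hat
variable {V ε : Type} [Fintype V] [DecidableEq ε] [Finite ε] (D : ℕ) (π : ε → Sym2 V)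
  (R : Finset V)

theorem part_singleton {F : Finset ε} (h : F.Nonempty) : IsPartitionOf F {F} := by
  refine ⟨by simpa using h, by simp, by simp⟩

theorem part_exists (F : Finset ε) : ∃ P, IsPartitionOf F P := by
  rcases F.eq_empty_or_nonempty with rfl | h
  · exact ⟨∅, by simp [IsPartitionOf]⟩
  · exact ⟨_, part_singleton h⟩

theorem hat_fin (F : Finset ε) :
    {s : ℤ | ∃ P : Finset (Finset ε), IsPartitionOf F P ∧ s = ∑ p ∈ P, fCnt D π R p}.Finite := by
  have : Finite (Finset (Finset ε)) := inferInstance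
  apply (Set.finite_range (fun P : Finset (Finset ε) => ∑ p ∈ P, fCnt D π R p)).subset
  rintro s ⟨P, _, rfl⟩
  exact ⟨P, rfl⟩

theorem hat_attained (F : Finset ε) :
    ∃ P, IsPartitionOf F P ∧ fHat D π R F = ∑ p ∈ P, fCnt D π R p := by
  have := Int.csInf_mem (s := {s : ℤ | ∃ P : Finset (Finset ε), IsPartitionOf F P ∧
    s = ∑ p ∈ P, fCnt D π R p}) (by
      obtain ⟨P, hP⟩ := part_exists F
      exact ⟨_, P, hP, rfl⟩) (hat_fin D π R F).bddBelow
  exact this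

theorem hat_le {F : Finset ε} {P : Finset (Finset ε)} (hP : IsPartitionOf F P) :
    fHat D π R F ≤ ∑ p ∈ P, fCnt D π R p :=
  csInf_le (hat_fin D π R F).bddBelow ⟨P, hP, rfl⟩

theorem hat_le_f {F : Finset ε} (h : F.Nonempty) : fHat D π R F ≤ fCnt D π R F := by
  simpa using hat_le D π R (part_singleton h)

theorem part_sub {F : Finset ε} {P : Finset (Finset ε)} (hP : IsPartitionOf F P)
    {p : Finset ε} (hp : p ∈ P) : p ⊆ F := by
  rw [← hP.2.2]
  exact Finset.subset_biUnion_of_mem id hp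

theorem part_eq {F : Finset ε} {P : Finset (Finset ε)} (hP : IsPartitionOf F P)
    {p q : Finset ε} (hp : p ∈ P) (hq : q ∈ P) {e : ε} (h1 : e ∈ p) (h2 : e ∈ q) : p = q := by
  by_contra h
  exact Finset.disjoint_left.1 (hP.2.1 hp hq h) h1 h2

theorem part_cov {F : Finset ε} {P : Finset (Finset ε)} (hP : IsPartitionOf F P)
    {e : ε} (he : e ∈ F) : ∃ p ∈ P, e ∈ p := by
  rw [← hP.2.2] at he
  simpa using he

theorem refine_part {F : Finset ε} {P : Finset (Finset ε)} (hP : IsPartitionOf F P) :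
    ∃ Q, IsPartitionOf F Q ∧ ∑ q ∈ Q, fCnt D π R q = ∑ p ∈ P, fHat D π R p ∧
      ∀ q ∈ Q, ∃ p ∈ P, q ⊆ p := by
  choose r hr hr2 using hat_attained D π R
  refine ⟨P.biUnion r, ⟨?_, ?_, ?_⟩, ?_, ?_⟩
  · intro q hq
    obtain ⟨p, hp, hq⟩ := Finset.mem_biUnion.1 hq
    exact (hr p).1 q hq
  · intro q hq q' hq' hne
    obtain ⟨p, hp, hq⟩ := Finset.mem_biUnion.1 hq
    obtain ⟨p', hp', hq'⟩ := Finset.mem_biUnion.1 hq'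
    refine Finset.disjoint_left.2 fun e h1 h2 => ?_
    have := part_eq hP hp hp' (part_sub (hr p) hq h1) (part_sub (hr p') hq' h2)
    subst this
    exact hne (part_eq (hr p) hq hq' h1 h2)
  · ext e
    constructor
    · intro h
      obtain ⟨q, hq, he⟩ := Finset.mem_biUnion.1 h
      obtain ⟨p, hp, hq⟩ := Finset.mem_biUnion.1 hq
      exact part_sub hP hp (part_sub (hr p) hq he)
    · intro h
      obtain ⟨p, hp, he⟩ := part_cov hP h
      obtain ⟨q, hq, he⟩ := part_cov (hr p) he
      exact Finset.mem_biUnion.2 ⟨q, Finset.mem_biUnion.2 ⟨p, hp, hq⟩, he⟩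
  · rw [Finset.sum_biUnion]
    · exact Finset.sum_congr rfl fun p _ => (hr2 p).symm
    · intro p hp p' hp' hne
      refine Finset.disjoint_left.2 fun q h1 h2 => ?_
      obtain ⟨e, he⟩ := (hr p).1 q h1
      exact hne (part_eq hP hp hp' (part_sub (hr p) h1 he) (part_sub (hr p') h2 he))
  · intro q hq
    obtain ⟨p, hp, hq⟩ := Finset.mem_biUnion.1 hq
    exact ⟨p, hp, part_sub (hr p) hq⟩

theorem hat_lt {C : Finset ε} (hC : PConn D π R C) {P : Finset (Finset ε)}
    (hP : IsPartitionOf C P) (h2 : 2 ≤ P.card) : fHat D π R C < ∑ p ∈ P, fCnt D π R p := by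
  have h := hC.2 P hP h2
  obtain ⟨Q, hQ, hs, _⟩ := refine_part D π R hP
  have h3 := hat_le D π R hQ
  have h4 : ∑ p ∈ P, fHat D π R p ≤ ∑ p ∈ P, fCnt D π R p :=
    Finset.sum_le_sum fun p hp => hat_le_f D π R (hP.1 p hp)
  omega

theorem hat_eq {C : Finset ε} (hC : PConn D π R C) : fHat D π R C = fCnt D π R C := by
  obtain ⟨Q, hQ, hs⟩ := hat_attained D π R C
  have h1 : Q.card < 2 := by
    by_contra h
    have := hat_lt D π R hC hQ (by omega)
    omega
  obtain ⟨e, he⟩ := hC.1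
  obtain ⟨p, hp, _⟩ := part_cov hQ he
  have : Q.card = 1 := by have := Finset.card_pos.2 ⟨p, hp⟩; omega
  obtain ⟨q, rfl⟩ := Finset.card_eq_one.1 this
  have h3 := hQ.2.2
  simp at h3
  subst h3
  simpa using hs

theorem uncross (hD : 1 ≤ D) (C : Finset ε) (T : Finset (Finset ε))
    (hT : (T : Set (Finset ε)).PairwiseDisjoint id) :
    fCnt D π R (C ∪ T.biUnion id) + ∑ G ∈ T, fCnt D π R (G ∩ C) ≤
      fCnt D π R C + ∑ G ∈ T, fCnt D π R G := by
  induction T using Finset.induction_on with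
  | empty => simp
  | insert A T hA ih =>
    have ih := ih (hT.subset (by simp))
    rw [Finset.sum_insert hA, Finset.sum_insert hA, Finset.biUnion_insert]
    have h := fCnt_submod D hD π R (C ∪ T.biUnion id) A
    have e1 : (C ∪ T.biUnion id) ∪ A = C ∪ (id A ∪ T.biUnion id) := by
      simp only [id]; ext x; simp only [Finset.mem_union]; tauto
    have e2 : (C ∪ T.biUnion id) ∩ A = A ∩ C := by
      ext x
      simp only [Finset.mem_inter, Finset.mem_union, Finset.mem_biUnion, id]
      constructor
      · rintro ⟨h | ⟨G, hG, hx⟩, hxA⟩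
        · exact ⟨hxA, h⟩
        · exfalso
          have hne : G ≠ A := by rintro rfl; exact hA hG
          exact Finset.disjoint_left.1
            (hT (Finset.mem_coe.2 (Finset.mem_insert_of_mem hG))
              (Finset.mem_coe.2 (Finset.mem_insert_self A T)) hne) hx hxA
      · rintro ⟨h1, h2⟩; exact ⟨Or.inl h2, h1⟩
    rw [e1, e2] at h
    omega

theorem single_part (hD : 1 ≤ D) {C F : Finset ε} (hC : PConn D π R C) (hCF : C ⊆ F)
    {Q : Finset (Finset ε)} (hQ : IsPartitionOf F Q)
    (hs : ∑ q ∈ Q, fCnt D π R q = fHat D π R F) : ∃ q ∈ Q, C ⊆ q := by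
  set Q1 := Q.filter (fun G => (G ∩ C).Nonempty) with hQ1
  have hsub : Q1 ⊆ Q := Finset.filter_subset _ _
  have hcov : ∀ e ∈ C, ∃ q ∈ Q1, e ∈ q := by
    intro e he
    obtain ⟨q, hq, heq⟩ := part_cov hQ (hCF he)
    exact ⟨q, Finset.mem_filter.2 ⟨hq, e, Finset.mem_inter.2 ⟨heq, he⟩⟩, heq⟩
  obtain ⟨e0, he0⟩ := hC.1
  obtain ⟨q0, hq0, heq0⟩ := hcov e0 he0
  by_cases hcard : 2 ≤ Q1.card
  · exfalso
    have hinj : Set.InjOn (fun G : Finset ε => G ∩ C) Q1 := by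
      intro A hA B hB hAB
      obtain ⟨hA, e, he⟩ := Finset.mem_filter.1 hA
      have he' : e ∈ B ∩ C := by have hAB : A ∩ C = B ∩ C := hAB; rw [← hAB]; exact he
      exact part_eq hQ hA (hsub hB) (Finset.mem_inter.1 he).1 (Finset.mem_inter.1 he').1
    have hP : IsPartitionOf C (Q1.image (fun G => G ∩ C)) := by
      refine ⟨?_, ?_, ?_⟩
      · intro p hp
        obtain ⟨G, hG, rfl⟩ := Finset.mem_image.1 hp
        exact (Finset.mem_filter.1 hG).2
      · intro p hp p' hp' hne
        obtain ⟨G, hG, rfl⟩ := Finset.mem_image.1 hp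
        obtain ⟨G', hG', rfl⟩ := Finset.mem_image.1 hp'
        refine Finset.disjoint_left.2 fun e h1 h2 => hne ?_
        rw [part_eq hQ (hsub hG) (hsub hG') (Finset.mem_inter.1 h1).1 (Finset.mem_inter.1 h2).1]
      · ext e
        simp only [Finset.mem_biUnion, Finset.mem_image, id]
        constructor
        · rintro ⟨_, ⟨G, hG, rfl⟩, he⟩
          exact (Finset.mem_inter.1 he).2
        · intro he
          obtain ⟨q, hq, heq⟩ := hcov e he
          exact ⟨_, ⟨q, hq, rfl⟩, Finset.mem_inter.2 ⟨heq, he⟩⟩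
    have h1 := hat_lt D π R hC hP (by rw [Finset.card_image_of_injOn hinj]; exact hcard)
    rw [hat_eq D π R hC, Finset.sum_image hinj] at h1
    have h2 := uncross D π R hD C Q1 (hQ.2.1.subset (by exact_mod_cast hsub))
    have hCU : C ∪ Q1.biUnion id = Q1.biUnion id := by
      apply Finset.union_eq_right.2
      intro e he
      obtain ⟨q, hq, heq⟩ := hcov e he
      exact Finset.mem_biUnion.2 ⟨q, hq, heq⟩
    rw [hCU] at h2
    set H := Q1.biUnion id with hH
    have hmemH : ∀ e, e ∈ H ↔ ∃ q ∈ Q1, e ∈ q := by intro e; simp [hH]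
    have hHd : ∀ q ∈ Q \ Q1, Disjoint H q := by
      intro q hq
      refine Finset.disjoint_left.2 fun e h1 h2 => ?_
      obtain ⟨q', hq', he⟩ := (hmemH e).1 h1
      obtain ⟨hq, hn⟩ := Finset.mem_sdiff.1 hq
      rw [part_eq hQ hq (hsub hq') h2 he] at hn
      exact hn hq'
    have hHn : H.Nonempty := ⟨e0, (hmemH _).2 ⟨q0, hq0, heq0⟩⟩
    have hHnot : H ∉ Q \ Q1 := by
      intro h
      have := hHd H h
      rw [disjoint_self] at this
      exact hHn.ne_empty this
    have hQ' : IsPartitionOf F (insert H (Q \ Q1)) := by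
      refine ⟨?_, ?_, ?_⟩
      · intro p hp
        rcases Finset.mem_insert.1 hp with rfl | hp
        · exact hHn
        · exact hQ.1 p (Finset.mem_sdiff.1 hp).1
      · intro p hp p' hp' hne
        rcases Finset.mem_insert.1 (Finset.mem_coe.1 hp) with h | hp <;>
        rcases Finset.mem_insert.1 (Finset.mem_coe.1 hp') with h' | hp'
        · exact absurd (h.trans h'.symm) hne
        · rw [h]; exact hHd _ hp'
        · rw [h']; exact (hHd _ hp).symm
        · exact hQ.2.1 (Finset.mem_sdiff.1 hp).1 (Finset.mem_sdiff.1 hp').1 hne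
      · ext e
        rw [Finset.biUnion_insert, Finset.mem_union]
        constructor
        · rintro (h | h)
          · obtain ⟨q, hq, he⟩ := (hmemH e).1 h
            exact part_sub hQ (hsub hq) he
          · obtain ⟨q, hq, he⟩ := Finset.mem_biUnion.1 h
            exact part_sub hQ (Finset.mem_sdiff.1 hq).1 he
        · intro h
          obtain ⟨q, hq, he⟩ := part_cov hQ h
          by_cases hq1 : q ∈ Q1
          · exact Or.inl ((hmemH e).2 ⟨q, hq1, he⟩)
          · exact Or.inr (Finset.mem_biUnion.2 ⟨q, Finset.mem_sdiff.2 ⟨hq, hq1⟩, he⟩)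
    have h3 := hat_le D π R hQ'
    rw [Finset.sum_insert hHnot] at h3
    have h4 := Finset.sum_sdiff (f := fCnt D π R) hsub
    omega
  · refine ⟨q0, hsub hq0, fun e he => ?_⟩
    obtain ⟨q, hq, heq⟩ := hcov e he
    have : q = q0 := Finset.card_le_one.1 (by omega) q hq q0 hq0
    exact this ▸ heq

theorem key (hD : 1 ≤ D) {E C : Finset ε} (hC : PConnComp D π R E C) (w : ε → ℤ)
    (hw : ∀ Z ⊆ E, Disjoint Z C → Z.Nonempty → ∑ e ∈ Z, w e ≤ fCnt D π R Z) :
    ∀ Z ⊆ E, Disjoint Z C → fCnt D π R C + ∑ e ∈ Z, w e ≤ fCnt D π R (C ∪ Z) := by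
  intro Z
  induction Z using Finset.strongInduction with
  | H Z ih =>
  intro hZE hZC
  by_contra hlt
  have hne : Z.Nonempty := by
    rw [Finset.nonempty_iff_ne_empty]
    rintro rfl
    simp at hlt
  have hFn : (C ∪ Z).Nonempty := hne.mono Finset.subset_union_right
  have hconn : PConn D π R (C ∪ Z) := by
    refine ⟨hFn, fun P hP h2 heq => ?_⟩
    obtain ⟨Q, hQ, hs, hsub⟩ := refine_part D π R hP
    rw [← heq] at hs
    obtain ⟨G, hG, hCG⟩ := single_part D π R hD hC.2.1 Finset.subset_union_left hQ hs
    have hGne : ¬ (C ∪ Z ⊆ G) := by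
      intro h
      obtain ⟨p, hp, hGp⟩ := hsub G hG
      obtain ⟨p', hp', hne'⟩ := Finset.exists_mem_ne (by omega : 1 < P.card) p
      obtain ⟨e, he⟩ := hP.1 p' hp'
      exact hne' (part_eq hP hp' hp he (hGp (h (part_sub hP hp' he))))
    have hGF := part_sub hQ hG
    have hZ1 : G \ C ⊆ Z := by
      intro e he
      obtain ⟨h1, h2⟩ := Finset.mem_sdiff.1 he
      rcases Finset.mem_union.1 (hGF h1) with h | h
      · exact absurd h h2
      · exact h
    have hZ1' : G \ C ⊂ Z := by
      refine ⟨hZ1, fun h => hGne ?_⟩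
      exact Finset.union_subset hCG (h.trans Finset.sdiff_subset)
    have h1 := ih _ hZ1' (hZ1.trans hZE) (Finset.sdiff_disjoint)
    rw [Finset.union_sdiff_of_subset hCG] at h1
    have h3 : ∀ q ∈ Q.erase G, ∑ e ∈ q, w e ≤ fCnt D π R q := by
      intro q hq
      obtain ⟨hqG, hq⟩ := Finset.mem_erase.1 hq
      have hd : Disjoint q C := by
        refine Finset.disjoint_left.2 fun e he heC => hqG ?_
        exact part_eq hQ hq hG he (hCG heC)
      refine hw q ?_ hd (hQ.1 q hq)
      intro e he
      rcases Finset.mem_union.1 (part_sub hQ hq he) with h | h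
      · exact hC.1 h
      · exact hZE h
    have h4 := Finset.sum_le_sum h3
    have h5 := Finset.sum_erase_add Q (fCnt D π R) hG
    have h6 : ∑ q ∈ Q.erase G, ∑ e ∈ q, w e + ∑ e ∈ G, w e = ∑ e ∈ C ∪ Z, w e := by
      rw [Finset.sum_erase_add Q (fun q => ∑ e ∈ q, w e) hG]
      conv_rhs => rw [← hQ.2.2]
      exact (Finset.sum_biUnion hQ.2.1).symm
    have h7 := Finset.sum_sdiff (f := w) hCG
    rw [Finset.sum_union hZC.symm] at h6
    have h8 := hat_le_f D π R hFn
    omega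
  have := hC.2.2 _ (Finset.union_subset hC.1 hZE) hconn Finset.subset_union_left
  obtain ⟨e, he⟩ := hne
  exact Finset.disjoint_left.1 hZC he (this ▸ Finset.mem_union_right C he)

end hat

theorem exists_circ {V ε : Type} [Fintype V] (D : ℕ) (π : ε → Sym2 V) (R : Finset V)
    (F : Finset ε) (h : ¬ CIndep D π R F) : ∃ C ⊆ F, CCircuit D π R C := by
  induction F using Finset.strongInduction with
  | H F ih =>
  by_cases hc : ∀ C' ⊂ F, CIndep D π R C'
  · exact ⟨F, subset_rfl, h, hc⟩
  · push Not at hc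
    obtain ⟨C', hC', hn⟩ := hc
    obtain ⟨K, hK, hc⟩ := ih C' hC' hn
    exact ⟨K, hK.trans hC'.1, hc⟩

theorem gW_image {V : Type} [DecidableEq (Option V)] (D : ℕ) (R U : Finset V) :
    gW D (R.image some : Finset (Option V)) (U.image some) = gW D R U := by
  unfold gW
  rw [Finset.sum_image (Option.some_injective V).injOn]
  simp

theorem gW_insert {V : Type} [DecidableEq (Option V)] (D : ℕ) (R U : Finset V) :
    gW D (R.image some : Finset (Option V)) (insert none (U.image some)) = D + gW D R U := by
  rw [← gW_image D R U]
  unfold gW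
  rw [Finset.sum_insert (by simp)]
  simp

theorem mem_fCopy {V ε : Type} [Fintype V] [DecidableEq ε] (D : ℕ) (π : ε → Sym2 V)
    (R : Finset V) (F : Finset ε) (y : ε × Fin D) :
    y ∈ fCopy D π R F ↔ y.1 ∈ F ∧ (y.2 : ℕ) < fMult D π R y.1 := by
  unfold fCopy
  simp only [Finset.mem_biUnion, Finset.mem_product, Finset.mem_singleton, Finset.mem_filter,
    Finset.mem_univ, true_and]
  constructor
  · rintro ⟨e, he, rfl, h⟩; exact ⟨he, h⟩
  · rintro ⟨h1, h2⟩; exact ⟨_, h1, rfl, h2⟩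

theorem fMult_star {V : Type} [Fintype V] [DecidableEq (Option V)] (D : ℕ) (hD : 1 ≤ D)
    (R : Finset V) (v : V) :
    (fMult D (id : Sym2 (Option V) → Sym2 (Option V)) (R.image some)
      s((none : Option V), some v) : ℤ) ≤ gW D R {v} := by
  unfold fMult gW
  rw [Finset.sum_singleton]
  split_ifs with h
  · have key : ∀ A : Finset (Option V), some v ∈ A → ((D - A.card : ℕ) : ℤ) ≤ (D : ℤ) - 1 := by
      intro A hA
      have := Finset.card_pos.2 ⟨_, hA⟩
      omega
    apply key
    simp [mem_VF, h]
  · omega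

theorem fCnt_nonneg {V : Type} [Fintype V] (D : ℕ) (hD : 2 ≤ D) (R : Finset V)
    (Z : Finset (Sym2 V)) (hne : Z.Nonempty) (hl : ∀ e ∈ Z, ¬ e.IsDiag) :
    0 ≤ fCnt D (id : Sym2 V → Sym2 V) R Z := by
  obtain ⟨e, he⟩ := hne
  have h2 : 2 ≤ (VF (id : Sym2 V → Sym2 V) Z).card := by
    have hd := hl e he
    induction e using Sym2.ind with
    | _ a b =>
    have hab : a ≠ b := by simpa using hd
    rw [← Finset.card_pair hab]
    apply Finset.card_le_card
    intro v hv
    rw [mem_VF]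
    refine ⟨_, he, ?_⟩
    simpa using hv
  unfold fCnt
  have h3 : (VF (id : Sym2 V → Sym2 V) Z ∩ R).card ≤ (VF (id : Sym2 V → Sym2 V) Z).card :=
    Finset.card_le_card Finset.inter_subset_left
  generalize (VF (id : Sym2 V → Sym2 V) Z ∩ R).card = m at *
  generalize (VF (id : Sym2 V → Sym2 V) Z).card = n at *
  zify at *
  nlinarith

theorem circ_main (V : Type) [Fintype V] [DecidableEq V] [DecidableEq (Sym2 V)]
    [DecidableEq (Option V)]
    (E : Finset (Sym2 V)) (hE : ∀ s ∈ E, ¬ s.IsDiag) (R : Finset V)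
    (D : ℕ) (hD : 2 ≤ D)
    (C : Finset (Sym2 V)) (hC : PConnComp D (id : Sym2 V → Sym2 V) R E C)
    (Cc : Finset (Sym2 (Option V) × Fin D))
    (hCc : ∀ y ∈ Cc, ((∃ e ∈ E, e ∉ C ∧ y.1 = Sym2.map some e) ∨
      (∃ v ∈ VF (id : Sym2 V → Sym2 V) C, y.1 = s((none : Option V), some v))) ∧
      (y.2 : ℕ) < fMult D (id : Sym2 (Option V) → Sym2 (Option V)) (R.image some) y.1)
    (hcirc : CCircuit D (fun y : Sym2 (Option V) × Fin D => y.1) (R.image some) Cc)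
    (x : Sym2 (Option V) × Fin D) (hx : ∃ v, x.1 = s((none : Option V), some v)) : x ∉ Cc := by
  intro hxC
  have hD1 : 1 ≤ D := by omega
  set fib : Sym2 V → Finset (Sym2 (Option V) × Fin D) :=
    fun e => Cc.filter (fun y => y.1 = Sym2.map some e) with hfib
  set fibS : V → Finset (Sym2 (Option V) × Fin D) :=
    fun v => Cc.filter (fun y => y.1 = s((none : Option V), some v)) with hfibS
  have hinj : Function.Injective (Sym2.map (some : V → Option V)) :=
    Sym2.map.injective (Option.some_injective V)
  have hnn : ∀ (e : Sym2 V) , (none : Option V) ∉ Sym2.map some e := by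
    intro e h; simp [Sym2.mem_map] at h
  have hkey := key D (id : Sym2 V → Sym2 V) R hD1 hC (fun e => ((fib e).card : ℤ)) (by
    intro Z hZE hZC hZ
    have hcard : ∑ e ∈ Z, ((fib e).card : ℤ) = ((Z.biUnion fib).card : ℤ) := by
      rw [Finset.card_biUnion]
      · push_cast; rfl
      · intro e _ e' _ hne
        refine Finset.disjoint_left.2 fun y h1 h2 => hne (hinj ?_)
        rw [← (Finset.mem_filter.1 h1).2, ← (Finset.mem_filter.1 h2).2]
    rw [hcard]
    have hmem : ∀ y ∈ Z.biUnion fib, y ∈ Cc ∧ ∃ e ∈ Z, y.1 = Sym2.map some e := by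
      intro y hy
      obtain ⟨e, he, hy⟩ := Finset.mem_biUnion.1 hy
      exact ⟨(Finset.mem_filter.1 hy).1, e, he, (Finset.mem_filter.1 hy).2⟩
    rcases (Z.biUnion fib).eq_empty_or_nonempty with h0 | h0
    · rw [h0]
      simpa using fCnt_nonneg D hD R Z hZ (fun e he => hE e (hZE he))
    · have hss : Z.biUnion fib ⊂ Cc := by
        refine ⟨fun y hy => (hmem y hy).1, fun h => ?_⟩
        obtain ⟨e, _, he⟩ := (hmem x (h hxC)).2
        obtain ⟨v, hv⟩ := hx
        apply hnn e
        rw [← he, hv]; simp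
      have h1 := hcirc.2 _ hss _ subset_rfl h0
      refine h1.trans ?_
      rw [fCnt_eq, fCnt_eq, ← gW_image D R (VF id Z)]
      have : VF (fun y : Sym2 (Option V) × Fin D => y.1) (Z.biUnion fib) ⊆
          (VF (id : Sym2 V → Sym2 V) Z).image some := by
        intro u hu
        obtain ⟨y, hy, hu⟩ := (mem_VF _ _ _).1 hu
        obtain ⟨_, e, he, hye⟩ := hmem y hy
        rw [hye, Sym2.mem_map] at hu
        obtain ⟨a, ha, rfl⟩ := hu
        exact Finset.mem_image_of_mem _ ((mem_VF _ _ _).2 ⟨e, he, ha⟩)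
      have := gW_mono D hD1 (R.image some) this
      omega)
  set Z0 := E.filter (fun e => e ∉ C ∧ ∃ y ∈ Cc, y.1 = Sym2.map some e) with hZ0
  set W := (VF (id : Sym2 V → Sym2 V) C).filter
    (fun v => ∃ y ∈ Cc, y.1 = s((none : Option V), some v)) with hW
  have hk := hkey Z0 (Finset.filter_subset _ _)
    (Finset.disjoint_left.2 fun e he => (Finset.mem_filter.1 he).2.1)
  have hWb : ∀ v ∈ W, ((fibS v).card : ℤ) ≤ gW D R {v} := by
    intro v hv
    refine le_trans ?_ (fMult_star D hD1 R v)
    norm_cast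
    have : (fibS v).card = ((fibS v).image (fun y => (y.2 : ℕ))).card := by
      rw [Finset.card_image_of_injOn]
      intro y hy y' hy' h
      have h1 := (Finset.mem_filter.1 (Finset.mem_coe.1 hy)).2
      have h2 := (Finset.mem_filter.1 (Finset.mem_coe.1 hy')).2
      exact Prod.ext (h1.trans h2.symm) (Fin.ext h)
    rw [this]
    conv_rhs => rw [← Finset.card_range (fMult D id (R.image some) s((none : Option V), some v))]
    apply Finset.card_le_card
    intro n hn
    obtain ⟨y, hy, rfl⟩ := Finset.mem_image.1 hn
    obtain ⟨hy, he⟩ := Finset.mem_filter.1 hy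
    rw [Finset.mem_range, ← he]
    exact (hCc y hy).2
  have hWs : ∑ v ∈ W, ((fibS v).card : ℤ) ≤ gW D R W := by
    refine (Finset.sum_le_sum hWb).trans (le_of_eq ?_)
    simp only [gW, Finset.sum_singleton]
  have hcardle : (Cc.card : ℤ) ≤ ∑ e ∈ Z0, ((fib e).card : ℤ) + ∑ v ∈ W, ((fibS v).card : ℤ) := by
    have hsub : Cc ⊆ Z0.biUnion fib ∪ W.biUnion fibS := by
      intro y hy
      rcases (hCc y hy).1 with ⟨e, he, heC, hye⟩ | ⟨v, hv, hyv⟩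
      · exact Finset.mem_union_left _ (Finset.mem_biUnion.2
          ⟨e, Finset.mem_filter.2 ⟨he, heC, y, hy, hye⟩, Finset.mem_filter.2 ⟨hy, hye⟩⟩)
      · exact Finset.mem_union_right _ (Finset.mem_biUnion.2
          ⟨v, Finset.mem_filter.2 ⟨hv, y, hy, hyv⟩, Finset.mem_filter.2 ⟨hy, hyv⟩⟩)
    have h1 := Finset.card_le_card hsub
    have h2 := Finset.card_union_le (Z0.biUnion fib) (W.biUnion fibS)
    have h3 := Finset.card_biUnion_le (s := Z0) (t := fib)
    have h4 := Finset.card_biUnion_le (s := W) (t := fibS)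
    have h5 : Cc.card ≤ ∑ e ∈ Z0, (fib e).card + ∑ v ∈ W, (fibS v).card := by omega
    exact_mod_cast h5
  have hVsub : insert none ((W ∪ VF (id : Sym2 V → Sym2 V) Z0).image some) ⊆
      VF (fun y : Sym2 (Option V) × Fin D => y.1) Cc := by
    intro u hu
    rw [mem_VF]
    rcases Finset.mem_insert.1 hu with rfl | hu
    · obtain ⟨v, hv⟩ := hx
      exact ⟨x, hxC, by rw [hv]; simp⟩
    · obtain ⟨v, hv, rfl⟩ := Finset.mem_image.1 hu
      rcases Finset.mem_union.1 hv with hv | hv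
      · obtain ⟨_, y, hy, hyv⟩ := Finset.mem_filter.1 hv
        exact ⟨y, hy, by rw [hyv]; simp⟩
      · obtain ⟨e, he, hve⟩ := (mem_VF _ _ _).1 hv
        obtain ⟨_, _, y, hy, hye⟩ := Finset.mem_filter.1 he
        exact ⟨y, hy, by rw [hye]; exact Sym2.mem_map.2 ⟨v, hve, rfl⟩⟩
  have h1 := gW_mono D hD1 (R.image some) hVsub
  rw [gW_insert, gW_union_sdiff] at h1
  rw [fCnt_eq, fCnt_eq, VF_union, gW_union_sdiff] at hk
  have hWC : W ⊆ VF (id : Sym2 V → Sym2 V) C := Finset.filter_subset _ _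
  have h2 := gW_mono D hD1 R
    (Finset.sdiff_subset_sdiff (subset_refl (VF (id : Sym2 V → Sym2 V) Z0)) hWC)
  have hfin : (Cc.card : ℤ) ≤ fCnt D (fun y : Sym2 (Option V) × Fin D => y.1) (R.image some) Cc := by
    rw [fCnt_eq]
    omega
  apply hcirc.1
  intro F hF hne
  rcases eq_or_ne F Cc with rfl | h
  · exact hfin
  · exact hcirc.2 F (hF.ssubset_of_ne h) F subset_rfl hne

theorem statement_17
    (V : Type) [Fintype V] [DecidableEq V]
    (E : Finset (Sym2 V)) (hE : ∀ s ∈ E, ¬ s.IsDiag)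
    (B R : Finset V) (hdisj : Disjoint B R) (hcov : B ∪ R = Finset.univ)
    (d D : ℕ) (hd : 3 ≤ d) (hD : D = (d + 1).choose 2)
    (C : Finset (Sym2 V)) (hC : PConnComp D (id : Sym2 V → Sym2 V) R E C)
    (hC2 : 2 ≤ C.card)
    -- the star `S` joining the new vertex `v_c = none` to the vertices of `V(C)`
    (S : Finset (Sym2 (Option V)))
    (hS : S = (VF (id : Sym2 V → Sym2 V) C).image
      (fun w : V => s((none : Option V), (some w : Option V))))
    -- the edge set of the simplified graph `G'`
    (E' : Finset (Sym2 (Option V)))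
    (hE' : E' = (E \ C).image (Sym2.map some) ∪ S)
    -- the vertex bipartition `P' = {B ∪ {v_c}, R}` of `G'`
    (R' : Finset (Option V)) (hR' : R' = R.image some) :
    ∀ x ∈ fCopy D (id : Sym2 (Option V) → Sym2 (Option V)) R' S,
      (∀ Bs ⊆ fCopy D (id : Sym2 (Option V) → Sym2 (Option V)) R' E',
        CIndep D (fun y : Sym2 (Option V) × Fin D => y.1) R' Bs →
        (∀ Bs' ⊆ fCopy D (id : Sym2 (Option V) → Sym2 (Option V)) R' E',
          CIndep D (fun y : Sym2 (Option V) × Fin D => y.1) R' Bs' → Bs ⊆ Bs' → Bs' = Bs) →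
        x ∈ Bs) ∧
      (∀ Cc ⊆ fCopy D (id : Sym2 (Option V) → Sym2 (Option V)) R' E',
        CCircuit D (fun y : Sym2 (Option V) × Fin D => y.1) R' Cc → x ∉ Cc) := by
  subst hS hE' hR'
  have hD2 : 2 ≤ D := by
    rw [hD, Nat.choose_two_right]
    have : 4 * 3 ≤ (d + 1) * (d + 1 - 1) := Nat.mul_le_mul (by omega) (by omega)
    omega
  intro x hx
  have hxs := ((mem_fCopy _ _ _ _ _).1 hx).1
  have hxv : ∃ v, x.1 = s((none : Option V), some v) := by
    obtain ⟨v, _, hv⟩ := Finset.mem_image.1 hxs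
    exact ⟨v, hv.symm⟩
  have hcirc : ∀ Cc ⊆ fCopy D (id : Sym2 (Option V) → Sym2 (Option V)) (R.image some)
      ((E \ C).image (Sym2.map some) ∪ (VF (id : Sym2 V → Sym2 V) C).image
      (fun w : V => s((none : Option V), (some w : Option V)))),
      CCircuit D (fun y : Sym2 (Option V) × Fin D => y.1) (R.image some) Cc → x ∉ Cc := by
    intro Cc hsub hc
    refine circ_main V E hE R D hD2 C hC Cc ?_ hc x hxv
    intro y hy
    obtain ⟨h1, h2⟩ := (mem_fCopy _ _ _ _ _).1 (hsub hy)
    refine ⟨?_, h2⟩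
    rcases Finset.mem_union.1 h1 with h | h
    · obtain ⟨e, he, hh⟩ := Finset.mem_image.1 h
      exact Or.inl ⟨e, (Finset.mem_sdiff.1 he).1, (Finset.mem_sdiff.1 he).2, hh.symm⟩
    · obtain ⟨v, hv, hh⟩ := Finset.mem_image.1 h
      exact Or.inr ⟨v, hv, hh.symm⟩
  refine ⟨?_, hcirc⟩
  intro Bs hBs hind hmax
  by_contra hxB
  have hxE : x ∈ fCopy D (id : Sym2 (Option V) → Sym2 (Option V)) (R.image some)
      ((E \ C).image (Sym2.map some) ∪ (VF (id : Sym2 V → Sym2 V) C).image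
      (fun w : V => s((none : Option V), (some w : Option V)))) :=
    (mem_fCopy _ _ _ _ _).2 ⟨Finset.mem_union_right _ hxs, ((mem_fCopy _ _ _ _ _).1 hx).2⟩
  have hins := Finset.insert_subset hxE hBs
  have hdep : ¬ CIndep D (fun y : Sym2 (Option V) × Fin D => y.1) (R.image some)
      (insert x Bs) := by
    intro h
    have := hmax _ hins h (Finset.subset_insert _ _)
    exact hxB (this ▸ Finset.mem_insert_self x Bs)
  obtain ⟨K, hK, hc⟩ := exists_circ _ _ _ _ hdep
  have hxK := hcirc K (hK.trans hins) hc
  apply hc.1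
  intro F hF hne
  refine hind F ?_ hne
  intro y hy
  rcases Finset.mem_insert.1 (hK (hF hy)) with rfl | h
  · exact absurd (hF hy) hxK
  · exact h
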